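/- If C is a self-dual linear code of length n over R (that is, C = C^⊥ with respect to the Euclidean inner product), then its Gray image Ψ(C) is a self-dual linear code of length 3n over F_q, i.e. Ψ(C) = Ψ(C)^⊥. -/

import Mathlib

open Polynomial

/-- The ring `R = F_q[v]/(v³ - v)`, where `v` is the image of `X`. -/
abbrev Rv (F : Type) [Field F] : Type := AdjoinRoot (X ^ 3 - X : F[X])

lemma monicV (F : Type) [Field F] : (X ^ 3 - X : F[X]).Monic :=
  Polynomial.monic_X_pow_sub (by simp)

/-- The `i`-th coefficient of the canonical representation `a₀ + a₁ v + a₂ v²`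
of an element of `R`. -/
noncomputable def coefR (F : Type) [Field F] (i : ℕ) (x : Rv F) : F :=
  (AdjoinRoot.modByMonicHom (monicV F) x).coeff i

/-- The Gray map `Ψ : Rⁿ → F_q^{3n}`, sending each coordinate
`a₀ + a₁ v + a₂ v²` to the triple `(a₀, a₀ + a₂, a₁)`. -/
noncomputable def gray (F : Type) [Field F] {n : ℕ} (x : Fin n → Rv F) :
    Fin n × Fin 3 → F :=
  fun p => ![coefR F 0 (x p.1), coefR F 0 (x p.1) + coefR F 2 (x p.1), coefR F 1 (x p.1)] p.2

/-- The dual of a code with respect to the Euclidean inner product `x·y = Σᵢ xᵢ yᵢ`. -/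
def dualSet {A : Type} [CommRing A] {ι : Type} [Fintype ι] (C : Set (ι → A)) :
    Set (ι → A) :=
  {x | ∀ c ∈ C, ∑ i, x i * c i = 0}

/-- Hamming weight: the number of nonzero coordinates. -/
noncomputable def hWt {A : Type} [Zero A] {ι : Type} [Fintype ι] (x : ι → A) : ℕ :=
  Nat.card {i // x i ≠ 0}

/-- Lee weight: the Hamming weight of the Gray image. -/
noncomputable def leeWt (F : Type) [Field F] {n : ℕ} (x : Fin n → Rv F) : ℕ :=
  hWt (gray F x)

/-- The cyclic (right) shift `(c₀, …, c_{n-1}) ↦ (c_{n-1}, c₀, …, c_{n-2})`. -/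
def rshift {A : Type} {n : ℕ} (x : Fin n → A) : Fin n → A :=
  fun i => x ((finRotate n).symm i)

/-- A code is cyclic if it is closed under the cyclic shift. -/
def IsCyclicCode {A : Type} {n : ℕ} (C : Set (Fin n → A)) : Prop :=
  ∀ x ∈ C, rshift x ∈ C

/-- The element `a + b v + c v²` of `R`. -/
noncomputable def ofCoeffs {F : Type} [Field F] (a b c : F) : Rv F :=
  AdjoinRoot.mk _ (C a + C b * X + C c * X ^ 2)

section

variable {F : Type} [Field F]

lemma natDegree_X_pow_three_sub_X : (X ^ 3 - X : F[X]).natDegree = 3 := by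
  compute_degree!

lemma coefR_ofCoeffs (a b c : F) (i : ℕ) :
    coefR F i (ofCoeffs a b c) = (C a + C b * X + C c * X ^ 2 : F[X]).coeff i := by
  rw [coefR, ofCoeffs, AdjoinRoot.modByMonicHom_mk, (modByMonic_eq_self_iff (monicV F)).2]
  rw [degree_eq_natDegree (monicV F).ne_zero, natDegree_X_pow_three_sub_X]
  refine lt_of_le_of_lt (b := 2) ?_ (by norm_num)
  compute_degree

@[simp] lemma coefR_zero_ofCoeffs (a b c : F) : coefR F 0 (ofCoeffs a b c) = a := by
  simp [coefR_ofCoeffs]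

@[simp] lemma coefR_one_ofCoeffs (a b c : F) : coefR F 1 (ofCoeffs a b c) = b := by
  simp [coefR_ofCoeffs, coeff_X_pow, coeff_C]

@[simp] lemma coefR_two_ofCoeffs (a b c : F) : coefR F 2 (ofCoeffs a b c) = c := by
  simp [coefR_ofCoeffs]

lemma ofCoeffs_coefR (x : Rv F) : ofCoeffs (coefR F 0 x) (coefR F 1 x) (coefR F 2 x) = x := by
  have hdeg : (AdjoinRoot.modByMonicHom (monicV F) x).natDegree < 3 := by
    obtain ⟨p, rfl⟩ := AdjoinRoot.mk_surjective x
    rw [AdjoinRoot.modByMonicHom_mk]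
    refine (natDegree_modByMonic_lt p (monicV F) fun h => ?_).trans_eq natDegree_X_pow_three_sub_X
    have h' := congrArg natDegree h
    rw [natDegree_X_pow_three_sub_X, natDegree_one] at h'
    omega
  conv_rhs => rw [← AdjoinRoot.mk_leftInverse (monicV F) x, as_sum_range_C_mul_X_pow' _ hdeg]
  simp [ofCoeffs, coefR, Finset.sum_range_succ]

lemma ofCoeffs_mul (a b c a' b' c' : F) :
    ofCoeffs a b c * ofCoeffs a' b' c' =
      ofCoeffs (a * a') (a * b' + b * a' + b * c' + c * b')
        (a * c' + b * b' + c * a' + c * c') := by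
  rw [ofCoeffs, ofCoeffs, ofCoeffs, ← map_mul, AdjoinRoot.mk_eq_mk]
  refine ⟨C (b * c' + c * b') + C (c * c') * X, ?_⟩
  simp only [map_add, map_mul]
  ring

variable (F) in
/-- The linear functional `2 a₀ + a₂` on `R`, which expresses the dot product of Gray images. -/
noncomputable def grayFunctional : Rv F →+ F where
  toFun x := 2 * coefR F 0 x + coefR F 2 x
  map_zero' := by simp [coefR]
  map_add' x y := by simp only [coefR, map_add, coeff_add]; ring

lemma grayFunctional_mul (x y : Rv F) :
    grayFunctional F (x * y) = coefR F 0 x * coefR F 0 y +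
      (coefR F 0 x + coefR F 2 x) * (coefR F 0 y + coefR F 2 y) + coefR F 1 x * coefR F 1 y := by
  conv_lhs => rw [← ofCoeffs_coefR x, ← ofCoeffs_coefR y, ofCoeffs_mul]
  simp only [grayFunctional, AddMonoidHom.coe_mk, ZeroHom.coe_mk, coefR_zero_ofCoeffs,
    coefR_two_ofCoeffs]
  ring

lemma sum_gray_mul_gray {n : ℕ} (x y : Fin n → Rv F) :
    ∑ p, gray F x p * gray F y p = grayFunctional F (∑ i, x i * y i) := by
  rw [map_sum, Fintype.sum_prod_type]
  refine Finset.sum_congr rfl fun i _ => ?_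
  simp [Fin.sum_univ_three, gray, grayFunctional_mul]

lemma eq_zero_of_grayFunctional_mul_eq_zero {s : Rv F}
    (hs : ∀ r, grayFunctional F (r * s) = 0) : s = 0 := by
  have h₀ := hs (ofCoeffs 1 0 (-1))
  have h₁ := hs (ofCoeffs 0 1 0)
  have h₂ := hs (ofCoeffs 0 0 1)
  simp only [grayFunctional_mul, coefR_zero_ofCoeffs, coefR_one_ofCoeffs,
    coefR_two_ofCoeffs] at h₀ h₁ h₂
  have e₀ : coefR F 0 s = 0 := by linear_combination h₀
  have e₁ : coefR F 1 s = 0 := by linear_combination h₁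
  have e₂ : coefR F 2 s = 0 := by linear_combination h₂ - e₀
  rw [← ofCoeffs_coefR s, e₀, e₁, e₂]
  simp [ofCoeffs]

lemma gray_surjective (n : ℕ) : Function.Surjective (gray F (n := n)) := by
  intro y
  refine ⟨fun i => ofCoeffs (y (i, 0)) (y (i, 2)) (y (i, 1) - y (i, 0)), ?_⟩
  ext ⟨i, j⟩
  fin_cases j <;> simp [gray]

end

/-- if a linear code `C ⊆ Rⁿ` is self-dual, then its Gray image
`Ψ(C) ⊆ F_q^{3n}` is self-dual. -/
theorem gray_image_self_dual (F : Type) [Field F] [Finite F] (n : ℕ)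
    (C : Submodule (Rv F) (Fin n → Rv F))
    (h : (C : Set (Fin n → Rv F)) = dualSet (C : Set (Fin n → Rv F))) :
    gray F '' (C : Set (Fin n → Rv F)) = dualSet (gray F '' (C : Set (Fin n → Rv F))) := by
  apply Set.Subset.antisymm
  · rintro _ ⟨x, hx, rfl⟩ _ ⟨c, hc, rfl⟩
    rw [h] at hx
    rw [sum_gray_mul_gray, hx c hc, map_zero]
  · intro y hy
    obtain ⟨x, rfl⟩ := gray_surjective n y
    refine ⟨x, ?_, rfl⟩
    rw [h]
    intro c hc
    refine eq_zero_of_grayFunctional_mul_eq_zero fun r => ?_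
    have hr := hy _ ⟨r • c, C.smul_mem r hc, rfl⟩
    rw [sum_gray_mul_gray] at hr
    simpa only [Finset.mul_sum, Pi.smul_apply, smul_eq_mul, mul_left_comm] using hr
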